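/- Let R = k[X,Y]^{(n)} ⊆ k[X,Y] be the n-th Veronese subring, generated by Zᵢ = X^i Y^{n-i}, 0 ≤ i ≤ n, over an algebraically closed field k of characteristic p with gcd(p,n) = 1. Then the Hilbert–Kunz function of R is HKF(R, p^e) = ((n+1)/2)·(p^{2e} - r²) + n·r(r+1)/2 + r - n, where r is the least nonnegative residue of p^e modulo n. -/

import Mathlib

open MvPolynomial

set_option synthInstance.maxHeartbeats 1000000
set_option maxHeartbeats 1000000

noncomputable section

/-- The generators `Zᵢ = X^i Y^{n-i}` of the `n`-th Veronese subring of `k[X,Y]`. -/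
def verGen (k : Type*) [Field k] (n : ℕ) : Fin (n + 1) → MvPolynomial (Fin 2) k :=
  fun i => X 0 ^ (i : ℕ) * X 1 ^ (n - (i : ℕ))

/-- The exponents `(a, b)` of the monomials `X^a Y^b` of the `n`-th Veronese subring that lie
outside the ideal `(Z₀^q, …, Zₙ^q)`. -/
def stdExps (n q : ℕ) : Finset (ℕ × ℕ) :=
  (Finset.range (n * q) ×ˢ Finset.range (n * q)).filter
    fun x => n ∣ x.1 + x.2 ∧ x.1 / q + x.2 / q < n

lemma mem_stdExps {n q : ℕ} (hq : 0 < q) {a b : ℕ} :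
    (a, b) ∈ stdExps n q ↔ n ∣ a + b ∧ a / q + b / q < n := by
  simp only [stdExps, Finset.mem_filter, Finset.mem_product, Finset.mem_range,
    and_iff_right_iff_imp]
  rintro ⟨-, h⟩
  exact ⟨(Nat.div_lt_iff_lt_mul hq).1 (by lia), (Nat.div_lt_iff_lt_mul hq).1 (by lia)⟩

lemma card_stdExps_low {n q : ℕ} (hn : 0 < n) (hq : 0 < q) :
    ((stdExps n q).filter fun x => x.1 + x.2 < n * q).card =
      ∑ w ∈ Finset.range q, (n * w + 1) := by
  have hT : ((Finset.range q).sigma fun w => Finset.HasAntidiagonal.antidiagonal (n * w)).card =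
      ∑ w ∈ Finset.range q, (n * w + 1) := by
    simp [Finset.card_sigma]
  rw [← hT]
  refine Finset.card_nbij' (fun x => ⟨(x.1 + x.2) / n, x⟩) (fun y => y.2) ?_ ?_ ?_ ?_
  · rintro ⟨a, b⟩ h
    simp only [Finset.coe_filter, Set.mem_ofPred_eq, mem_stdExps hq] at h
    simp only [Finset.coe_sigma, Set.mem_sigma_iff, Finset.mem_coe, Finset.mem_range,
      Finset.HasAntidiagonal.mem_antidiagonal]
    refine ⟨?_, (Nat.mul_div_cancel' h.1.1).symm⟩
    rw [Nat.div_lt_iff_lt_mul hn, mul_comm]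
    exact h.2
  · rintro ⟨w, a, b⟩ h
    simp only [Finset.coe_sigma, Set.mem_sigma_iff, Finset.mem_coe, Finset.mem_range,
      Finset.HasAntidiagonal.mem_antidiagonal] at h
    simp only [Finset.coe_filter, Set.mem_ofPred_eq, mem_stdExps hq]
    have hlt : a + b < n * q := by
      rw [h.2]
      exact Nat.mul_lt_mul_of_pos_left h.1 hn
    refine ⟨⟨⟨w, h.2⟩, ?_⟩, hlt⟩
    have ha := Nat.mul_div_le a q
    have hb := Nat.mul_div_le b q
    by_contra! hle
    nlinarith
  · rintro ⟨a, b⟩ _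
    rfl
  · rintro ⟨w, a, b⟩ h
    simp only [Finset.coe_sigma, Set.mem_sigma_iff, Finset.mem_coe, Finset.mem_range,
      Finset.HasAntidiagonal.mem_antidiagonal] at h
    simp [h.2, Nat.mul_div_cancel_left w hn]

lemma card_stdExps_high {n q : ℕ} (hn : 0 < n) (hq : 0 < q) :
    ((stdExps n q).filter fun x => ¬ x.1 + x.2 < n * q).card =
      ∑ j ∈ Finset.range (q / n + 1), n * (q - 1 - n * j) := by
  have hT : ((Finset.range (q / n + 1)).sigma fun j =>
      Finset.range n ×ˢ Finset.range (q - 1 - n * j)).card =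
      ∑ j ∈ Finset.range (q / n + 1), n * (q - 1 - n * j) := by
    simp [Finset.card_sigma]
  rw [← hT]
  refine Finset.card_nbij' (fun x => ⟨(x.1 + x.2 - n * q) / n, x.1 / q, q - 1 - x.2 % q⟩)
    (fun y => (q * y.2.1 + (n * y.1 + 1 + y.2.2), q * (n - 1 - y.2.1) + (q - 1 - y.2.2)))
    ?_ ?_ ?_ ?_
  · rintro ⟨a, b⟩ h
    simp only [Finset.coe_filter, Set.mem_ofPred_eq, mem_stdExps hq, not_lt] at h
    obtain ⟨⟨⟨w, hw⟩, hlt⟩, hle⟩ := h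
    simp only [Finset.coe_sigma, Set.mem_sigma_iff, Finset.mem_coe, Finset.mem_range,
      Finset.mem_product]
    have hqw : q ≤ w := Nat.le_of_mul_le_mul_left (hw ▸ hle) hn
    obtain ⟨j, rfl⟩ := Nat.exists_eq_add_of_le hqw
    have hj : (a + b - n * q) / n = j := by
      rw [hw, mul_add, Nat.add_sub_cancel_left, Nat.mul_div_cancel_left _ hn]
    rw [hj]
    have ha := Nat.div_add_mod a q
    have hb := Nat.div_add_mod b q
    have ha' := Nat.mod_lt a hq
    have hb' := Nat.mod_lt b hq
    have hs : q * (a / q) + q * (b / q) + q ≤ n * q := by nlinarith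
    rw [mul_add] at hw
    refine ⟨?_, (Nat.le_add_right _ _).trans_lt hlt, by omega⟩
    rw [Nat.lt_succ_iff, Nat.le_div_iff_mul_le hn, mul_comm]
    omega
  · rintro ⟨j, i, c⟩ h
    simp only [Finset.coe_sigma, Set.mem_sigma_iff, Finset.mem_coe, Finset.mem_range,
      Finset.mem_product] at h
    obtain ⟨-, hi, hc⟩ := h
    simp only [Finset.coe_filter, Set.mem_ofPred_eq, mem_stdExps hq, not_lt]
    obtain ⟨i', rfl⟩ := Nat.exists_eq_add_of_lt hi
    have hi' : i + i' + 1 - 1 - i = i' := by omega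
    rw [hi', Nat.mul_add_div hq, Nat.mul_add_div hq, Nat.div_eq_of_lt (by omega),
      Nat.div_eq_of_lt (by omega)]
    have hsum : q * i + ((i + i' + 1) * j + 1 + c) + (q * i' + (q - 1 - c)) =
        (i + i' + 1) * (q + j) := by
      have : 1 + c + (q - 1 - c) = q := by omega
      linear_combination this
    rw [hsum]
    exact ⟨⟨Dvd.intro _ rfl, by omega⟩, Nat.mul_le_mul_left _ (by omega)⟩
  · rintro ⟨a, b⟩ h
    simp only [Finset.coe_filter, Set.mem_ofPred_eq, mem_stdExps hq, not_lt] at h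
    obtain ⟨⟨⟨w, hw⟩, hlt⟩, hle⟩ := h
    have hqw : q ≤ w := Nat.le_of_mul_le_mul_left (hw ▸ hle) hn
    obtain ⟨j, rfl⟩ := Nat.exists_eq_add_of_le hqw
    have hj : (a + b - n * q) / n = j := by
      rw [hw, mul_add, Nat.add_sub_cancel_left, Nat.mul_div_cancel_left _ hn]
    have ha := Nat.div_add_mod a q
    have hb := Nat.div_add_mod b q
    have ha' := Nat.mod_lt a hq
    have hb' := Nat.mod_lt b hq
    have hab : a / q + b / q + 1 = n := by
      refine le_antisymm hlt ?_
      by_contra! hlt'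
      have : (a / q + b / q + 2) * q ≤ n * q := Nat.mul_le_mul_right q (by omega)
      nlinarith
    have hs : q * (a / q) + q * (b / q) + q = n * q := by
      rw [← hab]
      ring
    have hi' : n - 1 - a / q = b / q := by
      rw [← hab, Nat.add_sub_cancel, Nat.add_sub_cancel_left]
    rw [mul_add] at hw
    simp only [hj, hi', Prod.mk.injEq]
    exact ⟨by omega, by omega⟩
  · rintro ⟨j, i, c⟩ h
    simp only [Finset.coe_sigma, Set.mem_sigma_iff, Finset.mem_coe, Finset.mem_range,
      Finset.mem_product] at h
    obtain ⟨-, hi, hc⟩ := h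
    obtain ⟨i', rfl⟩ := Nat.exists_eq_add_of_lt hi
    have hi' : i + i' + 1 - 1 - i = i' := by omega
    have hsum : q * i + ((i + i' + 1) * j + 1 + c) + (q * i' + (q - 1 - c)) =
        (i + i' + 1) * q + (i + i' + 1) * j := by
      have : 1 + c + (q - 1 - c) = q := by omega
      linear_combination this
    have hmod : (q * i' + (q - 1 - c)) % q = q - 1 - c := by
      rw [Nat.mul_add_mod, Nat.mod_eq_of_lt (by omega)]
    simp only [hi', hsum, hmod, Nat.add_sub_cancel_left, Nat.mul_div_cancel_left _ hn]
    rw [Nat.mul_add_div hq, Nat.div_eq_of_lt (by omega)]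
    have hc' : q - 1 - (q - 1 - c) = c := by omega
    simp [hc']

lemma card_stdExps {n q : ℕ} (hn : 0 < n) (hr : 0 < q % n) :
    ((stdExps n q).card : ℚ) =
      ((n : ℚ) + 1) / 2 * ((q : ℚ) ^ 2 - ((q % n : ℕ) : ℚ) ^ 2) +
        (n : ℚ) * (((q % n : ℕ) : ℚ) * (((q % n : ℕ) : ℚ) + 1) / 2) +
        ((q % n : ℕ) : ℚ) - (n : ℚ) := by
  have hq : 0 < q := hr.trans_le (Nat.mod_le q n)
  have hlow (m : ℕ) : ∑ w ∈ Finset.range m, ((n : ℚ) * w + 1) = n * m * (m - 1) / 2 + m := by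
    induction m with
    | zero => simp
    | succ m ih =>
      rw [Finset.sum_range_succ, ih]
      push_cast
      ring
  have hhigh (m : ℕ) : ∑ j ∈ Finset.range m, (n : ℚ) * (q - 1 - n * j) =
      n * (m * (q - 1) - n * (m * (m - 1) / 2)) := by
    induction m with
    | zero => simp
    | succ m ih =>
      rw [Finset.sum_range_succ, ih]
      push_cast
      ring
  have hcast : ((∑ j ∈ Finset.range (q / n + 1), n * (q - 1 - n * j) : ℕ) : ℚ) =
      ∑ j ∈ Finset.range (q / n + 1), (n : ℚ) * (q - 1 - n * j) := by
    rw [Nat.cast_sum]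
    refine Finset.sum_congr rfl fun j hj => ?_
    have hj' : n * j ≤ n * (q / n) :=
      Nat.mul_le_mul_left n (Nat.lt_succ_iff.1 (Finset.mem_range.1 hj))
    have hdm := Nat.div_add_mod q n
    rw [Nat.cast_mul, Nat.cast_sub (by omega), Nat.cast_sub hq]
    push_cast
    ring
  rw [← Finset.card_filter_add_card_filter_not (s := stdExps n q)
    (fun x => x.1 + x.2 < n * q), card_stdExps_low hn hq, card_stdExps_high hn hq,
    Nat.cast_add, hcast, hhigh]
  push_cast
  rw [hlow]
  have hdm : (n : ℚ) * (q / n : ℕ) + (q % n : ℕ) = q := by exact_mod_cast Nat.div_add_mod q n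
  rw [← hdm]
  ring

/-- The exponent vector of `X^a Y^b`. -/
def expVec (a b : ℕ) : Fin 2 →₀ ℕ := Finsupp.single 0 a + Finsupp.single 1 b

@[simp] lemma expVec_zero (a b : ℕ) : expVec a b 0 = a := by simp [expVec]

@[simp] lemma expVec_one (a b : ℕ) : expVec a b 1 = b := by simp [expVec]

lemma expVec_eta (m : Fin 2 →₀ ℕ) : expVec (m 0) (m 1) = m := by
  ext i
  fin_cases i <;> simp

lemma expVec_add (a b c d : ℕ) : expVec a b + expVec c d = expVec (a + c) (b + d) := by
  ext i
  fin_cases i <;> simp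

lemma nsmul_expVec (q a b : ℕ) : q • expVec a b = expVec (q * a) (q * b) := by
  ext i
  fin_cases i <;> simp

lemma expVec_le {a b c d : ℕ} : expVec a b ≤ expVec c d ↔ a ≤ c ∧ b ≤ d := by
  simp [Finsupp.le_def, Fin.forall_fin_two]

section Veronese

variable (k : Type*) [Field k]

lemma verGen_eq_monomial (n : ℕ) (i : Fin (n + 1)) :
    verGen k n i = monomial (expVec i (n - i)) 1 := by
  simp [verGen, expVec, X_pow_eq_monomial, monomial_mul]

lemma verGen_pow_eq_monomial (n q : ℕ) (i : Fin (n + 1)) :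
    verGen k n i ^ q = monomial (expVec (q * i) (q * (n - i))) 1 := by
  rw [verGen_eq_monomial, monomial_pow, one_pow, nsmul_expVec]

lemma monomial_mem_veronese {n : ℕ} (w : ℕ) : ∀ (a b : ℕ), a + b = n * w → ∀ c : k,
    monomial (expVec a b) c ∈ Algebra.adjoin k (Set.range (verGen k n)) := by
  induction w with
  | zero =>
    intro a b h c
    obtain ⟨rfl, rfl⟩ : a = 0 ∧ b = 0 := by omega
    have : monomial (expVec 0 0) c = algebraMap k (MvPolynomial (Fin 2) k) c := by
      simp [expVec, algebraMap_eq]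
    rw [this]
    exact Subalgebra.algebraMap_mem _ c
  | succ w ih =>
    intro a b h c
    rw [mul_add, mul_one] at h
    have hi : min a n < n + 1 := by omega
    have hsplit : monomial (expVec a b) c =
        monomial (expVec (a - min a n) (b - (n - min a n))) c * verGen k n ⟨min a n, hi⟩ := by
      rw [verGen_eq_monomial, monomial_mul, mul_one, expVec_add,
        Nat.sub_add_cancel (by omega), Nat.sub_add_cancel (by omega)]
    rw [hsplit]
    exact mul_mem (ih _ _ (by omega) c) (Algebra.subset_adjoin (Set.mem_range_self _))

lemma dvd_of_mem_veronese {n : ℕ} {f : MvPolynomial (Fin 2) k}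
    (hf : f ∈ Algebra.adjoin k (Set.range (verGen k n))) :
    ∀ m ∈ f.support, n ∣ m 0 + m 1 := by
  classical
  induction hf using Algebra.adjoin_induction with
  | mem x hx =>
    obtain ⟨i, rfl⟩ := hx
    intro m hm
    rw [verGen_eq_monomial] at hm
    obtain rfl := Finset.mem_singleton.1 (support_monomial_subset hm)
    have := i.2
    simp [Nat.add_sub_cancel' (Nat.lt_succ_iff.1 this)]
  | algebraMap c =>
    intro m hm
    rw [algebraMap_eq, C_apply] at hm
    obtain rfl := Finset.mem_singleton.1 (support_monomial_subset hm)
    simp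
  | add f g _ _ ihf ihg =>
    intro m hm
    rcases Finset.mem_union.1 (support_add hm) with h | h
    exacts [ihf m h, ihg m h]
  | mul f g _ _ ihf ihg =>
    intro m hm
    obtain ⟨u, hu, v, hv, rfl⟩ := Finset.mem_add.1 (support_mul f g hm)
    have := dvd_add (ihf u hu) (ihg v hv)
    simp only [Finsupp.add_apply]
    rwa [add_add_add_comm]

/-- The ideal `(Z₀^q, …, Zₙ^q)` of the `n`-th Veronese subring. -/
abbrev verPowIdeal (n q : ℕ) : Ideal (Algebra.adjoin k (Set.range (verGen k n))) :=
  Ideal.span (Set.range fun i : Fin (n + 1) =>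
    (⟨verGen k n i, Algebra.subset_adjoin (Set.mem_range_self i)⟩ :
      Algebra.adjoin k (Set.range (verGen k n))) ^ q)

/-- The coefficients of an element of the Veronese subring at the exponents in `stdExps n q`. -/
def stdCoeffs (n q : ℕ) :
    Algebra.adjoin k (Set.range (verGen k n)) →ₗ[k] (stdExps n q → k) :=
  LinearMap.pi fun x => lcoeff k (expVec x.1.1 x.1.2) ∘ₗ
    (Algebra.adjoin k (Set.range (verGen k n))).val.toLinearMap

lemma stdCoeffs_apply (n q : ℕ) (f : Algebra.adjoin k (Set.range (verGen k n)))
    (x : stdExps n q) :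
    stdCoeffs k n q f x = coeff (expVec x.1.1 x.1.2) (f : MvPolynomial (Fin 2) k) := rfl

lemma stdCoeffs_surjective {n q : ℕ} (hq : 0 < q) :
    Function.Surjective (stdCoeffs k n q) := by
  classical
  rw [← LinearMap.range_eq_top, eq_top_iff, ← (Pi.basisFun k (stdExps n q)).span_eq,
    Submodule.span_le]
  rintro _ ⟨⟨⟨a, b⟩, hx⟩, rfl⟩
  obtain ⟨w, hw⟩ := ((mem_stdExps hq).1 hx).1
  refine ⟨⟨_, monomial_mem_veronese k w a b hw 1⟩, ?_⟩
  funext ⟨⟨c, d⟩, hy⟩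
  rw [stdCoeffs_apply, coeff_monomial, Pi.basisFun_apply, Pi.single_apply]
  refine if_congr ?_ rfl rfl
  simp only [Subtype.mk.injEq, Prod.mk.injEq]
  constructor
  · intro h
    have h0 := DFunLike.congr_fun h 0
    have h1 := DFunLike.congr_fun h 1
    simp only [expVec_zero, expVec_one] at h0 h1
    exact ⟨h0.symm, h1.symm⟩
  · rintro ⟨rfl, rfl⟩
    rfl

lemma monomial_mem_verPowIdeal {n q : ℕ} (hq : 0 < q) {a b : ℕ} (hdvd : n ∣ a + b)
    (hab : (a, b) ∉ stdExps n q) (c : k) :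
    ∃ f ∈ verPowIdeal k n q, (f : MvPolynomial (Fin 2) k) = monomial (expVec a b) c := by
  have hle : n ≤ a / q + b / q := by
    by_contra! h
    exact hab ((mem_stdExps hq).2 ⟨hdvd, h⟩)
  have hi : min (a / q) n < n + 1 := by omega
  set i := min (a / q) n with hidef
  have ha : q * i ≤ a := (Nat.mul_le_mul_left q (min_le_left _ _)).trans (Nat.mul_div_le a q)
  have hb : q * (n - i) ≤ b :=
    (Nat.mul_le_mul_left q (by lia)).trans (Nat.mul_div_le b q)
  have hmul : q * i + q * (n - i) = n * q := by
    rw [← mul_add, Nat.add_sub_cancel' (by omega), mul_comm]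
  have hdvd' : n ∣ (a - q * i) + (b - q * (n - i)) := by
    have : (a - q * i) + (b - q * (n - i)) = a + b - n * q := by omega
    rw [this]
    exact Nat.dvd_sub hdvd (Dvd.intro _ rfl)
  obtain ⟨w, hw⟩ := hdvd'
  refine ⟨⟨_, monomial_mem_veronese k w _ _ hw c⟩ *
    (⟨verGen k n ⟨i, hi⟩, Algebra.subset_adjoin (Set.mem_range_self _)⟩ :
      Algebra.adjoin k (Set.range (verGen k n))) ^ q,
    Ideal.mul_mem_left _ _ (Ideal.subset_span ⟨⟨i, hi⟩, rfl⟩), ?_⟩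
  rw [MulMemClass.coe_mul, SubmonoidClass.coe_pow, verGen_pow_eq_monomial, monomial_mul, mul_one,
    expVec_add, Nat.sub_add_cancel ha, Nat.sub_add_cancel hb]

lemma ker_stdCoeffs {n q : ℕ} (hq : 0 < q) :
    LinearMap.ker (stdCoeffs k n q) = (verPowIdeal k n q).restrictScalars k := by
  classical
  ext f
  rw [LinearMap.mem_ker, Submodule.restrictScalars_mem]
  constructor
  · intro hf
    have hmem : (f : MvPolynomial (Fin 2) k) ∈ ((verPowIdeal k n q).restrictScalars k).map
        (Algebra.adjoin k (Set.range (verGen k n))).val.toLinearMap := by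
      rw [(f : MvPolynomial (Fin 2) k).as_sum]
      refine Submodule.sum_mem _ fun m hm => ?_
      have hstd : (m 0, m 1) ∉ stdExps n q := by
        intro h
        have := congr_fun hf ⟨_, h⟩
        rw [stdCoeffs_apply, expVec_eta] at this
        exact mem_support_iff.1 hm this
      obtain ⟨g, hg, hgm⟩ := monomial_mem_verPowIdeal k hq (dvd_of_mem_veronese k f.2 m hm) hstd
        (coeff m (f : MvPolynomial (Fin 2) k))
      rw [expVec_eta] at hgm
      exact ⟨g, hg, hgm⟩
    obtain ⟨g, hg, hgf⟩ := hmem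
    rwa [← Subtype.ext (a1 := g) (a2 := f) hgf]
  · intro hf
    obtain ⟨c, rfl⟩ := (Submodule.mem_span_range_iff_exists_fun _).1 hf
    rw [map_sum]
    refine Finset.sum_eq_zero fun i _ => funext fun ⟨⟨a, b⟩, hx⟩ => ?_
    rw [stdCoeffs_apply, smul_eq_mul, MulMemClass.coe_mul, SubmonoidClass.coe_pow,
      verGen_pow_eq_monomial, coeff_mul_monomial', if_neg, Pi.zero_apply]
    rw [expVec_le]
    rintro ⟨ha, hb⟩
    have hlt := ((mem_stdExps hq).1 hx).2
    have ha' : (i : ℕ) ≤ a / q := (Nat.le_div_iff_mul_le hq).2 (mul_comm q _ ▸ ha)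
    have hb' : n - i ≤ b / q := (Nat.le_div_iff_mul_le hq).2 (mul_comm q _ ▸ hb)
    lia

lemma finrank_quotient_verPowIdeal {n q : ℕ} (hq : 0 < q) :
    Module.finrank k (Algebra.adjoin k (Set.range (verGen k n)) ⧸ verPowIdeal k n q) =
      (stdExps n q).card := by
  rw [← (Submodule.Quotient.restrictScalarsEquiv k (verPowIdeal k n q)).finrank_eq,
    ← ker_stdCoeffs k hq,
    ((stdCoeffs k n q).quotKerEquivOfSurjective (stdCoeffs_surjective k hq)).finrank_eq,
    Module.finrank_fintype_fun_eq_card, Fintype.card_coe]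

end Veronese

/-- Let `R ⊆ k[X,Y]` be the `n`-th Veronese subring, generated by `Zᵢ = X^i Y^{n-i}`,
over an algebraically closed field of characteristic `p` with `gcd(p,n) = 1`.  Then
`HKF(R, p^e) = dim_k R/(Z₀^{p^e},…,Zₙ^{p^e})
  = ((n+1)/2)·(p^{2e} - r²) + n·r(r+1)/2 + r - n`,
where `r = p^e mod n`. -/
theorem stmt14 (k : Type*) [Field k] [IsAlgClosed k] (p n : ℕ) (hp : p.Prime) [CharP k p]
    (hn : 2 ≤ n) (hgcd : Nat.gcd p n = 1) (e : ℕ) :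
    (Module.finrank k
        ((Algebra.adjoin k (Set.range (verGen k n))) ⧸
          Ideal.span (Set.range fun i : Fin (n + 1) =>
            (⟨verGen k n i, Algebra.subset_adjoin (Set.mem_range_self i)⟩ :
              Algebra.adjoin k (Set.range (verGen k n))) ^ p ^ e)) : ℚ) =
      ((n : ℚ) + 1) / 2 * ((p : ℚ) ^ (2 * e) - ((p ^ e % n : ℕ) : ℚ) ^ 2) +
        (n : ℚ) * (((p ^ e % n : ℕ) : ℚ) * (((p ^ e % n : ℕ) : ℚ) + 1) / 2) +
        ((p ^ e % n : ℕ) : ℚ) - (n : ℚ) := by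
  have hq : 0 < p ^ e := pow_pos hp.pos e
  have hr : 0 < p ^ e % n := by
    rw [Nat.pos_iff_ne_zero, Ne, ← Nat.dvd_iff_mod_eq_zero]
    intro h
    have hcop : Nat.Coprime (p ^ e) n := Nat.Coprime.pow_left e hgcd
    have := Nat.eq_one_of_dvd_coprimes hcop h dvd_rfl
    omega
  have h := card_stdExps (by omega) hr
  rw [← finrank_quotient_verPowIdeal k hq] at h
  rw [h]
  push_cast
  ring
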